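/- Let q/(q+1) < p < ∞, 1 < q < ∞, and r = pq/(pq+p−q). Then for all x ∈ [0, π_{p,q}/2), sin_{p,q}(x) = sinh_{r,q}(x) / (cosh_{r,q}(x))^{r/q}. -/

import Mathlib

open MeasureTheory Set
open scoped ENNReal

/-- `genF p q y = ∫_0^y (1 - t^q)^(-1/p) dt`, whose inverse is the generalized sine. -/
noncomputable def genF (p q y : ℝ) : ℝ := ∫ t in (0:ℝ)..y, (1 - t ^ q) ^ (-(1 / p))

/-- `genG p q y = ∫_0^y (1 + t^q)^(-1/p) dt`, whose inverse is the generalized hyperbolic sine. -/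
noncomputable def genG (p q y : ℝ) : ℝ := ∫ t in (0:ℝ)..y, (1 + t ^ q) ^ (-(1 / p))

/-- The generalized π, `π_{p,q} = 2∫_0^1 (1 - t^q)^(-1/p) dt`, as an extended real number
(it is `∞` when `q/(q+1) < p ≤ 1`). -/
noncomputable def genPi (p q : ℝ) : ℝ≥0∞ :=
  2 * ∫⁻ t in Ioo (0:ℝ) 1, ENNReal.ofReal ((1 - t ^ q) ^ (-(1 / p)))

/-- The generalized sine `sin_{p,q}`: the inverse of `genF p q`, which maps `[0,1)` onto
`[0, π_{p,q}/2)`. -/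
noncomputable def gsin (p q : ℝ) : ℝ → ℝ := Function.invFunOn (genF p q) (Ico 0 1)

/-- The generalized cosine `cos_{p,q} x = (d/dx) sin_{p,q} x` (one-sided at `x = 0`). -/
noncomputable def gcos (p q x : ℝ) : ℝ := derivWithin (gsin p q) (Ici 0) x

/-- The generalized hyperbolic sine `sinh_{p,q}`: the inverse of `genG p q`, which maps
`[0,∞)` onto `[0, π_{r,q}/2)` where `r = pq/(pq+p-q)`. -/
noncomputable def gsinh (p q : ℝ) : ℝ → ℝ := Function.invFunOn (genG p q) (Ici 0)

/-- The generalized hyperbolic cosine `cosh_{p,q} x = (d/dx) sinh_{p,q} x`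
(one-sided at `x = 0`). -/
noncomputable def gcosh (p q x : ℝ) : ℝ := derivWithin (gsinh p q) (Ici 0) x

lemma one_add_rpow_pos {t : ℝ} (q : ℝ) (ht : 0 ≤ t) : 0 < 1 + t ^ q := by
  have := Real.rpow_nonneg ht q
  linarith

lemma one_sub_rpow_pos {q t : ℝ} (hq : 0 < q) (ht : t ∈ Ico (0 : ℝ) 1) : 0 < 1 - t ^ q := by
  have := Real.rpow_lt_one ht.1 ht.2 hq
  linarith

lemma continuousOn_one_add_rpow {q : ℝ} (c : ℝ) (hq : 0 < q) :
    ContinuousOn (fun t : ℝ => (1 + t ^ q) ^ c) (Ici 0) := by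
  refine ContinuousOn.rpow_const ?_ fun t ht => Or.inl (one_add_rpow_pos q ht).ne'
  exact (continuous_const.add (Real.continuous_rpow_const hq.le)).continuousOn

lemma continuousOn_one_sub_rpow {q : ℝ} (c : ℝ) (hq : 0 < q) :
    ContinuousOn (fun t : ℝ => (1 - t ^ q) ^ c) (Ico 0 1) := by
  refine ContinuousOn.rpow_const ?_ fun t ht => Or.inl (one_sub_rpow_pos hq ht).ne'
  exact (continuous_const.sub (Real.continuous_rpow_const hq.le)).continuousOn

lemma uIcc_subset_Ici_zero {a b : ℝ} (ha : 0 ≤ a) (hb : 0 ≤ b) : uIcc a b ⊆ Ici 0 :=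
  fun _ hx => (le_min ha hb).trans hx.1

lemma uIcc_subset_Ico_zero_one {a b : ℝ} (ha : a ∈ Ico (0 : ℝ) 1) (hb : b ∈ Ico (0 : ℝ) 1) :
    uIcc a b ⊆ Ico 0 1 :=
  fun _ hx => ⟨(le_min ha.1 hb.1).trans hx.1, hx.2.trans_lt (max_lt ha.2 hb.2)⟩

/-- A primitive of a function that is continuous and positive on an order-connected set containing
the base point is strictly increasing there. -/
lemma strictMonoOn_integral_of_pos {f : ℝ → ℝ} {s : Set ℝ} {c : ℝ} (hs : s.OrdConnected)
    (hc : c ∈ s) (hf : ContinuousOn f s) (hpos : ∀ t ∈ s, 0 < f t) :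
    StrictMonoOn (fun y => ∫ t in c..y, f t) s := by
  intro a ha b hb hab
  have hint : ∀ u ∈ s, ∀ v ∈ s, IntervalIntegrable f volume u v := fun u hu v hv =>
    (hf.mono (hs.uIcc_subset hu hv)).intervalIntegrable
  have hadd := intervalIntegral.integral_add_adjacent_intervals (hint c hc a ha) (hint a ha b hb)
  have hlt := intervalIntegral.intervalIntegral_pos_of_pos_on (hint a ha b hb)
    (fun t ht => hpos t (hs.out ha hb ⟨ht.1.le, ht.2.le⟩)) hab
  show ∫ t in c..a, f t < ∫ t in c..b, f t
  linarith

lemma strictMonoOn_genG {q : ℝ} (r : ℝ) (hq : 0 < q) : StrictMonoOn (genG r q) (Ici 0) :=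
  strictMonoOn_integral_of_pos ordConnected_Ici self_mem_Ici (continuousOn_one_add_rpow _ hq)
    fun _ ht => Real.rpow_pos_of_pos (one_add_rpow_pos q ht) _

lemma strictMonoOn_genF {q : ℝ} (p : ℝ) (hq : 0 < q) : StrictMonoOn (genF p q) (Ico 0 1) :=
  strictMonoOn_integral_of_pos ordConnected_Ico (left_mem_Ico.2 one_pos)
    (continuousOn_one_sub_rpow _ hq)
    fun _ ht => Real.rpow_pos_of_pos (one_sub_rpow_pos hq ht) _

lemma gsin_genF {q s : ℝ} (p : ℝ) (hq : 0 < q) (hs : s ∈ Ico (0 : ℝ) 1) :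
    gsin p q (genF p q s) = s :=
  (strictMonoOn_genF p hq).injOn.leftInvOn_invFunOn hs

lemma gsinh_genG {q y : ℝ} (r : ℝ) (hq : 0 < q) (hy : 0 ≤ y) :
    gsinh r q (genG r q y) = y :=
  (strictMonoOn_genG r hq).injOn.leftInvOn_invFunOn hy

lemma hasStrictDerivAt_genG {q y : ℝ} (r : ℝ) (hq : 0 < q) (hy : 0 < y) :
    HasStrictDerivAt (genG r q) ((1 + y ^ q) ^ (-(1 / r))) y := by
  have hcont := continuousOn_one_add_rpow (-(1 / r)) hq
  refine intervalIntegral.integral_hasStrictDerivAt_right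
    (hcont.mono (uIcc_subset_Ici_zero le_rfl hy.le)).intervalIntegrable
    ?_ (hcont.continuousAt (Ici_mem_nhds hy))
  exact (hcont.mono Ioi_subset_Ici_self).stronglyMeasurableAtFilter isOpen_Ioi y hy

lemma gcosh_genG {q y : ℝ} (r : ℝ) (hq : 0 < q) (hy : 0 < y) :
    gcosh r q (genG r q y) = (1 + y ^ q) ^ (1 / r) := by
  have hpos := one_add_rpow_pos q hy.le
  have hinv : HasStrictDerivAt (gsinh r q) ((1 + y ^ q) ^ (-(1 / r)))⁻¹ (genG r q y) := by
    refine (hasStrictDerivAt_genG r hq hy).to_local_left_inverse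
      (Real.rpow_pos_of_pos hpos _).ne' ?_
    filter_upwards [Ioi_mem_nhds hy] with z hz using gsinh_genG r hq (le_of_lt hz)
  have h0 : 0 ≤ genG r q y := by
    have h := strictMonoOn_genG r hq self_mem_Ici hy.le hy
    simpa [genG] using h.le
  rw [gcosh, hinv.hasDerivAt.hasDerivWithinAt.derivWithin (uniqueDiffOn_Ici 0 _ h0),
    Real.rpow_neg hpos.le, inv_inv]

/-- Every `x ∈ [0, π_{p,q}/2)` is a value of `genF p q` on `[0, 1)`. -/
lemma exists_genF_eq {p q x : ℝ} (hq : 0 < q) (hx0 : 0 ≤ x)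
    (hx : ENNReal.ofReal x < genPi p q / 2) : ∃ s ∈ Ico (0 : ℝ) 1, genF p q s = x := by
  have hcont := continuousOn_one_sub_rpow (-(1 / p)) hq
  rw [genPi, mul_comm, ENNReal.mul_div_cancel_right two_ne_zero ENNReal.ofNat_ne_top] at hx
  have hcover : AECover (volume.restrict (Ioo (0 : ℝ) 1)) (nhdsWithin (1 : ℝ) (Iio 1))
      fun b => Ioc 0 b :=
    aecover_Ioo_of_Ioc tendsto_const_nhds (Filter.tendsto_id.mono_left nhdsWithin_le_nhds)
  have hmeas : AEMeasurable (fun t : ℝ => ENNReal.ofReal ((1 - t ^ q) ^ (-(1 / p))))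
      (volume.restrict (Ioo 0 1)) :=
    ((hcont.mono Ioo_subset_Ico_self).aemeasurable measurableSet_Ioo).ennreal_ofReal
  have hev := (hcover.lintegral_tendsto_of_countably_generated hmeas).eventually_const_lt hx
  obtain ⟨b, hb, hb0, hb1⟩ := (hev.and (Ioo_mem_nhdsLT one_pos)).exists
  have hb01 : b ∈ Ico (0 : ℝ) 1 := ⟨hb0.le, hb1⟩
  have hsub : uIcc 0 b ⊆ Ico 0 1 := uIcc_subset_Ico_zero_one (left_mem_Ico.2 one_pos) hb01
  have hint := (hcont.mono hsub).intervalIntegrable (μ := volume)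
  have hxb : x ≤ genF p q b := by
    have hnonneg : 0 ≤ᵐ[volume.restrict (Ioc 0 b)] fun t : ℝ => (1 - t ^ q) ^ (-(1 / p)) := by
      filter_upwards [ae_restrict_mem measurableSet_Ioc] with t ht
      exact Real.rpow_nonneg (one_sub_rpow_pos hq ⟨ht.1.le, ht.2.trans_lt hb1⟩).le _
    have hle : ENNReal.ofReal x ≤ ENNReal.ofReal (genF p q b) := by
      rw [genF, intervalIntegral.integral_of_le hb0.le,
        ofReal_integral_eq_lintegral_ofReal hint.1 hnonneg]
      refine hb.le.trans (lintegral_mono' ?_ le_rfl)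
      exact Measure.restrict_mono subset_rfl Measure.restrict_le_self
    have h0 : 0 ≤ genF p q b := by
      rw [genF, intervalIntegral.integral_of_le hb0.le]
      exact integral_nonneg_of_ae hnonneg
    exact (ENNReal.ofReal_le_ofReal_iff h0).1 hle
  have hF : ContinuousOn (genF p q) (Icc 0 b) := by
    rw [← uIcc_of_le hb0.le]
    exact intervalIntegral.continuousOn_primitive_interval' hint left_mem_uIcc
  obtain ⟨s, hs, hsx⟩ := intermediate_value_Icc hb0.le hF ⟨by simpa [genF] using hx0, hxb⟩
  exact ⟨s, ⟨hs.1, hs.2.trans_lt hb1⟩, hsx⟩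

lemma mul_one_add_rpow_rpow {q y : ℝ} (hq : 0 < q) (hy : 0 ≤ y) :
    1 - (y * (1 + y ^ q) ^ (-(1 / q))) ^ q = (1 + y ^ q)⁻¹ := by
  have hpos := one_add_rpow_pos q hy
  rw [Real.mul_rpow hy (Real.rpow_nonneg hpos.le _), ← Real.rpow_mul hpos.le,
    neg_mul, one_div_mul_cancel hq.ne', Real.rpow_neg_one]
  field_simp
  ring

lemma mul_one_add_rpow_mem_Ico {q y : ℝ} (hq : 0 < q) (hy : 0 ≤ y) :
    y * (1 + y ^ q) ^ (-(1 / q)) ∈ Ico (0 : ℝ) 1 := by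
  have hpos := one_add_rpow_pos q hy
  have h0 : 0 ≤ y * (1 + y ^ q) ^ (-(1 / q)) := mul_nonneg hy (Real.rpow_nonneg hpos.le _)
  refine ⟨h0, (Real.rpow_lt_one_iff' h0 hq).1 ?_⟩
  have := mul_one_add_rpow_rpow hq hy
  have := inv_pos.2 hpos
  linarith

lemma hasDerivAt_mul_one_add_rpow {q y : ℝ} (hq : 0 < q) (hy : 0 < y) :
    HasDerivAt (fun y : ℝ => y * (1 + y ^ q) ^ (-(1 / q)))
      ((1 + y ^ q) ^ (-(1 / q) - 1)) y := by
  have hpos := one_add_rpow_pos q hy.le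
  have hinner : HasDerivAt (fun y : ℝ => 1 + y ^ q) (q * y ^ (q - 1)) y :=
    (Real.hasDerivAt_rpow_const (Or.inl hy.ne')).const_add 1
  refine ((hasDerivAt_id y).mul (hinner.rpow_const (p := -(1 / q))
    (Or.inl hpos.ne'))).congr_deriv ?_
  have h1 : (1 + y ^ q) ^ (-(1 / q)) = (1 + y ^ q) ^ (-(1 / q) - 1) * (1 + y ^ q) := by
    rw [← Real.rpow_add_one hpos.ne', sub_add_cancel]
  have h2 : y ^ q = y ^ (q - 1) * y := by rw [← Real.rpow_add_one hy.ne', sub_add_cancel]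
  rw [h1]
  generalize (1 + y ^ q) ^ (-(1 / q) - 1) = A
  rw [h2]
  simp only [id]
  field_simp
  ring

/-- The substitution `s = y / (1 + y^q)^(1/q)` turns `genF p q` into `genG r q`. -/
lemma genF_mul_one_add_rpow {p q r y : ℝ} (hq : 0 < q) (hr : 1 / r = 1 + 1 / q - 1 / p)
    (hy : 0 ≤ y) : genF p q (y * (1 + y ^ q) ^ (-(1 / q))) = genG r q y := by
  have hIcc : uIcc 0 y ⊆ Ici 0 := uIcc_subset_Ici_zero le_rfl hy
  have hsubst := intervalIntegral.integral_comp_mul_deriv'' (a := 0) (b := y)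
    (f := fun y : ℝ => y * (1 + y ^ q) ^ (-(1 / q)))
    (f' := fun y : ℝ => (1 + y ^ q) ^ (-(1 / q) - 1))
    (g := fun t : ℝ => (1 - t ^ q) ^ (-(1 / p)))
    (continuousOn_id.mul ((continuousOn_one_add_rpow _ hq).mono hIcc))
    (fun t ht => by
      rw [min_eq_left hy] at ht
      exact (hasDerivAt_mul_one_add_rpow hq ht.1).hasDerivWithinAt)
    ((continuousOn_one_add_rpow _ hq).mono hIcc)
    ((continuousOn_one_sub_rpow _ hq).mono (by
      rintro _ ⟨t, ht, rfl⟩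
      exact mul_one_add_rpow_mem_Ico hq (hIcc ht)))
  rw [zero_mul] at hsubst
  rw [genF, ← hsubst, genG]
  refine intervalIntegral.integral_congr fun t ht => ?_
  have hpos := one_add_rpow_pos q (hIcc ht)
  simp only [Function.comp_apply]
  rw [mul_one_add_rpow_rpow hq (hIcc ht), Real.inv_rpow hpos.le, ← Real.rpow_neg hpos.le,
    ← Real.rpow_add hpos, hr]
  ring_nf

/-- The substitution `y ↦ y / (1 + y^q)^(1/q)` maps `[0, ∞)` onto `[0, 1)`. -/
lemma exists_mul_one_add_rpow_eq {q s : ℝ} (hq : 0 < q) (hs : s ∈ Ico (0 : ℝ) 1) :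
    ∃ y, 0 ≤ y ∧ y * (1 + y ^ q) ^ (-(1 / q)) = s := by
  have hpos := one_sub_rpow_pos hq hs
  refine ⟨s * (1 - s ^ q) ^ (-(1 / q)), mul_nonneg hs.1 (Real.rpow_nonneg hpos.le _), ?_⟩
  have h : 1 + (s * (1 - s ^ q) ^ (-(1 / q))) ^ q = (1 - s ^ q)⁻¹ := by
    rw [Real.mul_rpow hs.1 (Real.rpow_nonneg hpos.le _), ← Real.rpow_mul hpos.le,
      neg_mul, one_div_mul_cancel hq.ne', Real.rpow_neg_one]
    field_simp
    ring
  rw [h, Real.inv_rpow hpos.le, mul_assoc, mul_inv_cancel₀ (Real.rpow_pos_of_pos hpos _).ne',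
    mul_one]

/-- for `q/(q+1) < p < ∞`, `1 < q < ∞`, `r = pq/(pq+p-q)` and
`x ∈ [0, π_{p,q}/2)`, `sin_{p,q} x = sinh_{r,q} x / (cosh_{r,q} x)^(r/q)`. -/
theorem sin_eq_sinh_div_cosh_rpow (p q r : ℝ) (hq : 1 < q) (hp : q / (q + 1) < p)
    (hr : r = p * q / (p * q + p - q)) (x : ℝ) (hx0 : 0 ≤ x)
    (hx : ENNReal.ofReal x < genPi p q / 2) :
    gsin p q x = gsinh r q x / gcosh r q x ^ (r / q) := by
  have hq0 : 0 < q := one_pos.trans hq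
  have hp0 : 0 < p := (by positivity : 0 < q / (q + 1)).trans hp
  have hden : 0 < p * q + p - q := by
    rw [div_lt_iff₀ (by positivity)] at hp
    linarith
  have hr0 : 0 < r := hr ▸ by positivity
  have hr' : 1 / r = 1 + 1 / q - 1 / p := by
    rw [hr]
    field_simp
  obtain ⟨s, hs, rfl⟩ := exists_genF_eq hq0 hx0 hx
  obtain ⟨y, hy, rfl⟩ := exists_mul_one_add_rpow_eq hq0 hs
  rw [gsin_genF p hq0 hs, genF_mul_one_add_rpow hq0 hr' hy, gsinh_genG r hq0 hy]
  rcases hy.eq_or_lt with rfl | hy'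
  · simp
  · have hpos := one_add_rpow_pos q hy
    rw [gcosh_genG r hq0 hy', ← Real.rpow_mul hpos.le, div_mul_div_cancel₀ hr0.ne',
      Real.rpow_neg hpos.le, div_eq_mul_inv y]
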